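/- Let z ∈ I_ℤ and let a = a_1a_2⋯a_n ∈ R_inv(z) be an involution word. Then the map i ↦ γ_i(a) is a bijection from the set of commutations in a to the set cyc(z) of 2-cycles of z. -/

import Mathlib

/-! ## Primed letters: the alphabet `ℤ ⊔ ℤ'`, with `i' = i - 1/2`.
A letter is encoded by its "ceiling" together with a flag recording whether it is primed. -/

structure Letter where
  ceil : ℤ
  primed : Bool
deriving DecidableEq, Repr

instance : Inhabited Letter := ⟨⟨0, false⟩⟩

/-- The order `⋯ < 1' < 1 < 2' < 2 < ⋯`. -/
instance : LinearOrder Letter :=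
  LinearOrder.lift' (fun x : Letter => toLex (x.ceil, !x.primed))
    (fun a b h => by
      have h' : (a.ceil, !a.primed) = (b.ceil, !b.primed) := toLex.injective h
      obtain ⟨ac, ap⟩ := a
      obtain ⟨bc, bp⟩ := b
      simp only [Prod.mk.injEq] at h'
      obtain ⟨h1, h2⟩ := h'
      cases ap <;> cases bp <;> simp_all)

/-- A primed word. -/
abbrev PWord := List Letter

def Letter.unprime (x : Letter) : Letter := ⟨x.ceil, false⟩

def Letter.succL (x : Letter) : Letter := ⟨x.ceil + 1, x.primed⟩

/-- `unprime` of a primed word: replace each letter `x` by `⌈x⌉`. -/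
def unprimeWord (a : PWord) : List ℤ := a.map Letter.ceil

/-- `unprime` of a primed word, as a primed word with no primes. -/
def unprimeP (a : PWord) : PWord := a.map Letter.unprime

/-! ## Involution words -/

/-- The simple transposition `s_i = (i, i+1)` of `ℤ`. -/
def sPerm (i : ℤ) : Equiv.Perm ℤ := Equiv.swap i (i + 1)

/-- The Demazure product `s_{w_1} ∘ s_{w_2} ∘ ⋯ ∘ s_{w_k}` of a word, computed by the
defining recursion `σ ∘ s_i = σ·s_i` if `σ(i) < σ(i+1)` and `σ ∘ s_i = σ` otherwise. -/
def heckeProd (w : List ℤ) : Equiv.Perm ℤ :=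
  w.foldl (fun σ i => if σ i < σ (i + 1) then σ * sPerm i else σ) 1

/-- `s_{a_n} ∘ ⋯ ∘ s_{a_2} ∘ s_{a_1} ∘ s_{a_2} ∘ ⋯ ∘ s_{a_n}` for `a = a_1 a_2 ⋯ a_n`. -/
def invHecke (a : List ℤ) : Equiv.Perm ℤ := heckeProd (a.reverse ++ a.tail)

/-- Membership in `I_ℤ`: a finitely supported involution of `ℤ`. -/
def IZ (z : Equiv.Perm ℤ) : Prop := {x : ℤ | z x ≠ x}.Finite ∧ z * z = 1

/-- The set of involution words of `z`. -/
def Rinv (z : Equiv.Perm ℤ) : Set (List ℤ) :=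
  {a | invHecke a = z ∧ ∀ b : List ℤ, invHecke b = z → a.length ≤ b.length}

/-- 0-based index `k` is a commutation in the word `a` (this corresponds to the 1-based
index `k+1`): `a_{k+1}` and `a_{k+1} + 1` are both fixed points of
`s_{a_k} ∘ ⋯ ∘ s_{a_1} ∘ ⋯ ∘ s_{a_k}`. -/
def IsCommutation (a : List ℤ) (k : ℕ) : Prop :=
  ∃ x, a[k]? = some x ∧ invHecke (a.take k) x = x ∧ invHecke (a.take k) (x + 1) = x + 1

/-- The set of primed involution words of `z`. -/
def RinvPlus (z : Equiv.Perm ℤ) : Set PWord :=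
  {a | unprimeWord a ∈ Rinv z ∧
     ∀ (k : ℕ) (x : Letter), a[k]? = some x → x.primed = true →
       IsCommutation (unprimeWord a) k}

/-! ## Shifted tableaux.
A shifted tableau is recorded as its list of rows, from the first (bottom) row upward;
the entry at 0-based index `k` of 0-based row `r` occupies the box in row `r+1` and
column `r+1+k` of the shifted diagram. -/

abbrev STab := List (List Letter)

/-- A strict partition, recorded as its (strictly decreasing) list of positive parts. -/
def IsStrictPartition (sh : List ℕ) : Prop :=
  List.Chain' (fun a b => b < a) sh ∧ ∀ m ∈ sh, 0 < m

def shapeOf {α : Type*} (T : List (List α)) : List ℕ := T.map List.length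

/-- The rows form the shifted diagram of a strict partition. -/
def IsShifted {α : Type*} (T : List (List α)) : Prop := IsStrictPartition (shapeOf T)

/-- The entry of `T` in (0-based) row `r` and column `c` of the shifted diagram. -/
def entryG? {α : Type*} (T : List (List α)) (r c : ℕ) : Option α :=
  if r ≤ c then (T[r]?).bind (fun row => row[c - r]?) else none

def entry? (T : STab) (r c : ℕ) : Option Letter := entryG? T r c

def setRowG {α : Type*} (T : List (List α)) (r : ℕ) (row : List α) : List (List α) :=
  if r < T.length then T.set r row else T ++ [row]

def setEntryG {α : Type*} (T : List (List α)) (r c : ℕ) (x : α) : List (List α) :=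
  T.set r ((T.getD r []).set (c - r) x)

def numCols {α : Type*} (T : List (List α)) : ℕ := (T.getD 0 []).length

/-- Row reading word: rows left to right, starting with the last (top) row. -/
def rowWord (T : STab) : PWord := T.reverse.flatten

/-- Column reading word: columns top to bottom, starting with the first column. -/
def colWord (T : STab) : PWord :=
  (List.range (numCols T)).flatMap (fun c =>
    ((List.range (c + 1)).reverse).filterMap (fun r => entry? T r c))

def unprimeT (T : STab) : STab := T.map (List.map Letter.unprime)

/-- Remove the primes from all main-diagonal entries. -/
def unprimeDiagT (T : STab) : STab :=
  T.map (fun row =>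
    match row with
    | [] => []
    | x :: rest => Letter.unprime x :: rest)

/-- Rows and columns are strictly increasing. -/
def IsIncreasing (T : STab) : Prop :=
  (∀ r c x y, entry? T r c = some x → entry? T r (c + 1) = some y → x < y) ∧
  (∀ r c x y, entry? T r c = some x → entry? T (r + 1) c = some y → x < y)

/-- No primed entries on the main diagonal. -/
def NoDiagPrimes (T : STab) : Prop :=
  ∀ r x, entry? T r r = some x → x.primed = false

/-- Entries positive, rows and columns weakly increasing, no primed entry repeated
in a row and no unprimed entry repeated in a column. -/
def IsSemistandard (T : STab) : Prop :=
  (∀ x ∈ T.flatten, 0 < x.ceil) ∧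
  (∀ r c x y, entry? T r c = some x → entry? T r (c + 1) = some y → x ≤ y) ∧
  (∀ r c x y, entry? T r c = some x → entry? T (r + 1) c = some y → x ≤ y) ∧
  (∀ r c c' x, c < c' → entry? T r c = some x → entry? T r c' = some x →
    x.primed = false) ∧
  (∀ r r' c x, r < r' → entry? T r c = some x → entry? T r' c = some x →
    x.primed = true)

/-- Increasing, with exactly one of `i` or `i'` as an entry for each `i = 1, …, n`,
where `n` is the number of boxes. -/
def IsStandard (T : STab) : Prop :=
  IsIncreasing T ∧
  ∀ i : ℤ, 1 ≤ i → i ≤ (T.flatten.length : ℤ) →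
    T.flatten.countP (fun x => decide (x.ceil = i)) = 1
/-! ## Orthogonal Edelman–Greene insertion -/

/-- "Switching the primes" of a pair: reverse the primes on both letters if exactly one
of them is unprimed, and leave them unchanged otherwise. -/
def switchPrimes (x y : Letter) : Letter × Letter :=
  if x.primed = y.primed then (x, y)
  else (⟨x.ceil, !x.primed⟩, ⟨y.ceil, !y.primed⟩)

/-- Column-insertion stage of orthogonal Edelman–Greene insertion:
insert letter `w` into column `c` of `T` (then continue into later columns). -/
def egCol : ℕ → STab → ℕ → Letter → STab × Bool
  | 0, T, _, _ => (T, true)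
  | fuel + 1, T, c, w =>
    let occ := (List.range (c + 1)).filterMap (fun r => (entry? T r c).map (fun x => (r, x)))
    match occ.findIdx? (fun p => decide (w.ceil < p.2.ceil)) with
    | none =>
        -- place `w` in the first empty box of the column
        let r := occ.length
        let w' := if r = c ∧ w.primed then Letter.unprime w else w
        (setRowG T r ((T.getD r []) ++ [w']), if r = c then w.primed else true)
    | some kM =>
        let km := (occ.findIdx? (fun p => decide (w.ceil ≤ p.2.ceil))).getD kM
        let im := (occ.getD km (0, default)).1
        let m := (occ.getD km (0, default)).2
        if km = kM then
          if im = c then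
            -- m = M on the main diagonal
            egCol fuel (setEntryG T im c (Letter.unprime w)) (c + 1) ⟨m.ceil, w.primed⟩
          else
            -- m = M off the main diagonal
            egCol fuel (setEntryG T im c w) (c + 1) m
        else
          -- m < M : switch the primes on m and M, insert w+1 into the next column
          let iM := (occ.getD kM (0, default)).1
          let M := (occ.getD kM (0, default)).2
          let p := switchPrimes m M
          egCol fuel (setEntryG (setEntryG T im c p.1) iM c p.2) (c + 1) (Letter.succL w)

/-- Row-insertion stage of orthogonal Edelman–Greene insertion:
insert letter `w` into row `r` of `T`. -/
def egRow : ℕ → STab → ℕ → Letter → STab × Bool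
  | 0, T, _, _ => (T, true)
  | fuel + 1, T, r, w =>
    let row := T.getD r []
    match row.findIdx? (fun x => decide (w.ceil < x.ceil)) with
    | none =>
        if row.isEmpty ∧ w.primed then (setRowG T r [Letter.unprime w], true)
        else (setRowG T r (row ++ [w]), false)
    | some kM =>
        let km := (row.findIdx? (fun x => decide (w.ceil ≤ x.ceil))).getD kM
        let m := row.getD km default
        if km = kM then
          if km = 0 then
            -- m = M on the main diagonal
            egCol fuel (setRowG T r (row.set 0 (Letter.unprime w))) (r + 1)
              ⟨m.ceil, w.primed⟩
          else
            -- m = M off the main diagonal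
            egRow fuel (setRowG T r (row.set km w)) (r + 1) m
        else
          -- m < M : switch primes; insert w+1 into the next column (if m is on the
          -- main diagonal) or the next row (otherwise)
          let M := row.getD kM default
          let p := switchPrimes m M
          let row' := (row.set km p.1).set kM p.2
          if km = 0 then egCol fuel (setRowG T r row') (r + 1) (Letter.succL w)
          else egRow fuel (setRowG T r row') (r + 1) (Letter.succL w)

/-- `T ←ᴼ u` together with the flag recording whether the insertion ended in
column insertion. -/
def egInsert (T : STab) (u : Letter) : STab × Bool :=
  egRow (T.flatten.length + T.length + 2) T 0 u

/-- The orthogonal Edelman–Greene insertion tableau `P_EGᴼ(a)`. -/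
def PEG (a : PWord) : STab := a.foldl (fun T u => (egInsert T u).1) []

/-- Add the recording letter `x` to `Q` in the unique box of `Pnew` not in `Pold`. -/
def addBox (Q Pold Pnew : STab) (x : Letter) : STab :=
  match (List.range Pnew.length).find?
      (fun r => decide ((Pold.getD r []).length ≠ (Pnew.getD r []).length)) with
  | some r => setRowG Q r ((Q.getD r []) ++ [x])
  | none => Q

def QEGaux : STab → STab → ℕ → PWord → STab
  | _, Q, _, [] => Q
  | P, Q, n, u :: rest =>
      let res := egInsert P u
      QEGaux res.1 (addBox Q P res.1 ⟨(n : ℤ), res.2⟩) (n + 1) rest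

/-- The orthogonal Edelman–Greene recording tableau `Q_EGᴼ(a)`. -/
def QEG (a : PWord) : STab := QEGaux [] [] 1 a

/-! ## Orthogonal Coxeter–Knuth operators -/

def ock1 (x : Letter) : Letter := ⟨x.ceil, !x.primed⟩

def ock2 (x y : Letter) : Letter × Letter := (⟨y.ceil, x.primed⟩, ⟨x.ceil, y.primed⟩)

def ock3 (x y z : Letter) : Letter × Letter × Letter :=
  if x.ceil = z.ceil ∧ (x.ceil - y.ceil = 1 ∨ y.ceil - x.ceil = 1) then
    if x.primed = false ∧ y.primed = false ∧ z.primed = false then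
      -- XYX ↔ YXY
      (⟨y.ceil, false⟩, ⟨x.ceil, false⟩, ⟨y.ceil, false⟩)
    else if x.primed = true ∧ y.primed = false ∧ z.primed = false then
      -- X'YX ↦ YXY'
      (⟨y.ceil, false⟩, ⟨x.ceil, false⟩, ⟨y.ceil, true⟩)
    else if x.primed = false ∧ y.primed = false ∧ z.primed = true then
      -- YXY' ↦ X'YX
      (⟨y.ceil, true⟩, ⟨x.ceil, false⟩, ⟨y.ceil, false⟩)
    else (x, y, z)
  else if (x.ceil < z.ceil ∧ z.ceil < y.ceil) ∨ (y.ceil < z.ceil ∧ z.ceil < x.ceil) then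
    -- ACB ↔ CAB
    (y, x, z)
  else if (y.ceil < x.ceil ∧ x.ceil < z.ceil) ∨ (z.ceil < x.ceil ∧ x.ceil < y.ceil) then
    -- BCA ↔ BAC
    (x, z, y)
  else (x, y, z)

/-- The operator `ock_i` for `i ∈ ℤ`. -/
def ockW (i : ℤ) (a : PWord) : PWord :=
  if i = -1 then
    match a with
    | [] => []
    | x :: rest => ock1 x :: rest
  else if i = 0 then
    match a with
    | x :: y :: rest => (ock2 x y).1 :: (ock2 x y).2 :: rest
    | _ => a
  else if 1 ≤ i ∧ i + 2 ≤ (a.length : ℤ) then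
    let k := (i - 1).toNat
    match a[k]?, a[k + 1]?, a[k + 2]? with
    | some x, some y, some z =>
        a.take k ++ [(ock3 x y z).1, (ock3 x y z).2.1, (ock3 x y z).2.2] ++ a.drop (k + 3)
    | _, _, _ => a
  else a

/-- Orthogonal Coxeter–Knuth equivalence: generated by `a ∼ ock_i(a)` for all `i ∈ ℤ`. -/
def OckEquiv : PWord → PWord → Prop :=
  Relation.EqvGen (fun a b => ∃ i : ℤ, b = ockW i a)
/-! ## Descents -/

/-- Descent set of a primed word (as a set of 1-based positions). -/
def DesWord (a : PWord) : Set ℤ :=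
  {i | ∃ k : ℕ, i = (k : ℤ) + 1 ∧ ∃ x y, a[k]? = some x ∧ a[k + 1]? = some y ∧ y < x}

/-- Descent set of a standard shifted tableau. -/
def DesT (T : STab) : Set ℤ :=
  {i | 0 < i ∧ (
    (∃ r c r' c', entry? T r c = some ⟨i, false⟩ ∧
        entry? T r' c' = some ⟨i + 1, false⟩ ∧ r < r') ∨
    (∃ r c r' c', entry? T r c = some ⟨i, true⟩ ∧
        entry? T r' c' = some ⟨i + 1, true⟩ ∧ c < c') ∨
    (∃ r c r' c', entry? T r c = some ⟨i, false⟩ ∧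
        entry? T r' c' = some ⟨i + 1, true⟩))}

/-! ## Dual equivalence operators on standard shifted tableaux -/

def numPrimes (T : STab) : ℕ := T.flatten.countP (fun x => x.primed)

/-- The entries of column `c`, read from bottom to top (increasing). -/
def colLetters (T : STab) (c : ℕ) : PWord :=
  (List.range (c + 1)).filterMap (fun r => entry? T r c)

/-- The shifted reading word `unprime(C_q R_q ⋯ C_1 R_1)`. -/
def shword (T : STab) : List ℤ :=
  (((List.range (numCols T)).reverse).flatMap (fun idx =>
    (colLetters T idx).filter (fun x => x.primed) ++
      ((T.getD idx []).filter (fun x => !x.primed)))).map Letter.ceil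

def idxOfZ (v : ℤ) : List ℤ → ℕ
  | [] => 0
  | x :: r => if x = v then 0 else idxOfZ v r + 1

def positionsOf (T : STab) : List (ℕ × ℕ) :=
  (List.range T.length).flatMap (fun r =>
    (List.range (T.getD r []).length).map (fun k => (r, r + k)))

/-- The box `□_v` of `T` containing `v` or `v'`. -/
def boxOf (T : STab) (v : ℤ) : Option (ℕ × ℕ) :=
  (positionsOf T).find? (fun p =>
    match entry? T p.1 p.2 with
    | some x => decide (x.ceil = v)
    | none => false)

/-- Reverse the prime of the entry in position `(r, c)`. -/
def togglePos (T : STab) (r c : ℕ) : STab :=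
  match entry? T r c with
  | some x => setEntryG T r c ⟨x.ceil, !x.primed⟩
  | none => T

/-- Switch the primes of the entries in the two given positions. -/
def switchAt (T : STab) (p q : ℕ × ℕ) : STab :=
  match entry? T p.1 p.2, entry? T q.1 q.2 with
  | some x, some y =>
      if x.primed = y.primed then T else togglePos (togglePos T p.1 p.2) q.1 q.2
  | _, _ => T

/-- The row index of `□_v` if it is a main-diagonal box. -/
def diagBox? (T : STab) (v : ℤ) : Option ℕ :=
  (boxOf T v).bind (fun p => if p.1 = p.2 then some p.1 else none)

def switchDiag (T T' : STab) (u v : ℤ) : STab :=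
  match diagBox? T u, diagBox? T v with
  | some r, some s => switchAt T' (r, r) (s, s)
  | _, _ => T'

/-- The operator `𝔰_i`. -/
def sOp (i : ℤ) (T : STab) : STab :=
  match boxOf T i, boxOf T (i + 1) with
  | some (r1, c1), some (r2, c2) =>
      if r1 ≠ r2 ∧ c1 ≠ c2 then
        -- swap i ↔ i+1 and i' ↔ (i+1)'
        setEntryG (setEntryG T r1 c1 ⟨i + 1, ((entry? T r1 c1).getD default).primed⟩)
          r2 c2 ⟨i, ((entry? T r2 c2).getD default).primed⟩
      else if r1 ≠ c1 ∧ r2 ≠ c2 then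
        -- same row or column, neither box diagonal: reverse both primes
        togglePos (togglePos T r1 c1) r2 c2
      else
        -- same row or column, one box diagonal
        let T1 := if r1 = c1 then togglePos T r2 c2 else togglePos T r1 c1
        let T2 :=
          if 1 ≤ i - 1 ∧ (diagBox? T (i - 1)).isSome ∧ (diagBox? T (i + 1)).isSome then
            switchDiag T T1 (i - 1) (i + 1)
          else T1
        if i + 2 ≤ (T.flatten.length : ℤ) ∧ (diagBox? T i).isSome ∧
            (diagBox? T (i + 2)).isSome then
          switchDiag T T2 i (i + 2)
        else T2
  | _, _ => T

def btwn (a m b : ℕ) : Prop := (a < m ∧ m < b) ∨ (b < m ∧ m < a)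

instance (a m b : ℕ) : Decidable (btwn a m b) := by unfold btwn; infer_instance

/-- The dual equivalence operator `𝔡_i` for `i ∈ ℤ`. -/
def dOp (i : ℤ) (T : STab) : STab :=
  if ¬(1 ≤ i + 2 ∧ i + 2 ≤ (T.flatten.length : ℤ)) then T
  else if i = -1 then togglePos T 0 0
  else if i = 0 then togglePos T 0 1
  else
    let w := shword T
    if btwn (idxOfZ i w) (idxOfZ (i + 2) w) (idxOfZ (i + 1) w) then sOp i T
    else if btwn (idxOfZ (i + 1) w) (idxOfZ i w) (idxOfZ (i + 2) w) then sOp (i + 1) T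
    else T

/-! ## Marked cycles -/

/-- The 2-cycles of `z`, as ordered pairs `(i, j)` with `i < j = z(i)`. -/
def cycSet (z : Equiv.Perm ℤ) : Set (ℤ × ℤ) := {p | p.1 < p.2 ∧ z p.1 = p.2}

/-- `s_{a_n} ⋯ s_{a_{k+2}} s_{a_{k+1}}` (ordinary product; 0-based index `k`). -/
def suffixPerm (a : List ℤ) (k : ℕ) : Equiv.Perm ℤ :=
  ((a.drop (k + 1)).reverse.map sPerm).prod

/-- `γ_{k+1}(a)` as an ordered pair (junk value `(0,0)` off the commutation set). -/
def gammaPair (a : List ℤ) (k : ℕ) : ℤ × ℤ :=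
  match a[k]? with
  | some x => (min (suffixPerm a k x) (suffixPerm a k (x + 1)),
               max (suffixPerm a k x) (suffixPerm a k (x + 1)))
  | none => (0, 0)
/-! ## Increasing factorization sequences and Schur Q-functions -/

/-- `Incr_∞(R_inv^+(z))`: sequences of weakly increasing primed words, all but
finitely many empty, whose concatenation is a primed involution word for `z`. -/
def IncrSeq (z : Equiv.Perm ℤ) : Set (ℕ → PWord) :=
  {φ | (∀ n, List.Chain' (· ≤ ·) (φ n)) ∧
    ∃ N, (∀ n, N ≤ n → φ n = []) ∧ ((List.range N).map φ).flatten ∈ RinvPlus z}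

/-- Least bound past which a sequence of words is empty. -/
noncomputable def seqBound (φ : ℕ → PWord) : ℕ := sInf {N | ∀ n, N ≤ n → φ n = []}

/-- The concatenation `a^1 a^2 ⋯` of a sequence of words. -/
noncomputable def concatSeq (φ : ℕ → PWord) : PWord :=
  ((List.range (seqBound φ)).map φ).flatten

/-- `ℓ(a^1) + ⋯ + ℓ(a^i)`. -/
def prefLen (φ : ℕ → PWord) (i : ℕ) : ℕ := (((List.range i).map φ).map List.length).sum

/-- The minimal `i ≥ 1` with `j ≤ ℓ(a^1) + ⋯ + ℓ(a^i)`. -/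
noncomputable def relabel (φ : ℕ → PWord) (j : ℤ) : ℤ :=
  ((sInf {i : ℕ | 1 ≤ i ∧ j ≤ (prefLen φ i : ℤ)} : ℕ) : ℤ)

/-- The semistandard recording tableau `Q_EGᴼ(φ)`. -/
noncomputable def QEGseq (φ : ℕ → PWord) : STab :=
  (QEG (concatSeq φ)).map (List.map (fun x => (⟨relabel φ x.ceil, x.primed⟩ : Letter)))

/-- The insertion tableau `P_EGᴼ(φ)`. -/
noncomputable def PEGseq (φ : ℕ → PWord) : STab := PEG (concatSeq φ)

/-- The Schur Q-function of a strict partition: the coefficient of the monomial with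
exponent vector `d` is the number of semistandard shifted tableaux `T` of the given
shape with `x^T = x^d`. -/
noncomputable def SchurQ (sh : List ℕ) : MvPowerSeries ℤ ℤ :=
  fun d => (({T : STab | shapeOf T = sh ∧ IsSemistandard T ∧
    ∀ i : ℤ, d i = T.flatten.countP (fun x => decide (x.ceil = i))} : Set STab).ncard : ℤ)

/-- `Q_z = Σ_{φ ∈ Incr_∞(R_inv^+(z))} x^φ`. -/
noncomputable def Qz (z : Equiv.Perm ℤ) : MvPowerSeries ℤ ℤ :=
  fun d => (({φ : ℕ → PWord | φ ∈ IncrSeq z ∧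
    (∀ i : ℕ, d ((i : ℤ) + 1) = (φ i).length) ∧
    (∀ j : ℤ, j ≤ 0 → d j = 0)} : Set (ℕ → PWord)).ncard : ℤ)

/-! ## Dominant involutions -/

/-- The shifted diagram `SD_λ ⊆ ℤ × ℤ` of a strict partition. -/
def SDset (sh : List ℕ) : Set (ℤ × ℤ) :=
  {p | ∃ i j : ℕ, 1 ≤ i ∧ i ≤ sh.length ∧ 1 ≤ j ∧ j ≤ sh.getD (i - 1) 0 ∧
    p.1 = (i : ℤ) ∧ p.2 = (i : ℤ) + (j : ℤ) - 1}

/-- The involution Rothe diagram `D̂(z) = {(i,j) : z(i) > j ≤ i < z(j)}`. -/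
def invRothe (z : Equiv.Perm ℤ) : Set (ℤ × ℤ) :=
  {p | p.2 < z p.1 ∧ p.2 ≤ p.1 ∧ p.1 < z p.2}

/-- The tableau `T_λ` with entry `i + j - 1` in box `(i, j)` of `SD_λ`. -/
def Tlam (sh : List ℕ) : STab :=
  (List.range sh.length).map (fun r =>
    (List.range (sh.getD r 0)).map (fun k =>
      (⟨2 * (r : ℤ) + (k : ℤ) + 1, false⟩ : Letter)))

/-- The permutation `i + m ↦ w(i) + m` (fixing everything outside `m + support`). -/
def shiftPerm (m : ℕ) (w : Equiv.Perm ℤ) : Equiv.Perm ℤ :=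
  (Equiv.addLeft (m : ℤ)).permCongr w

/-- `z ∈ S_m`: `z` fixes every point outside `[1, m]`. -/
def SupportedOn (z : Equiv.Perm ℤ) (m : ℕ) : Prop :=
  ∀ x : ℤ, x < 1 ∨ (m : ℤ) < x → z x = x
/-! ## Primed compatible sequences -/

/-- A primed compatible sequence, recorded as the list of its columns `(index; value)`. -/
def IsPrimedCompatible (φ : List (ℕ × Letter)) : Prop :=
  (∀ p ∈ φ, 0 < p.1 ∧ 0 < p.2.ceil) ∧
  List.Chain' (fun p q : ℕ × Letter => p.1 ≤ q.1 ∧ (p.1 = q.1 → p.2 ≤ q.2)) φ ∧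
  (∀ (k l : ℕ) (p : ℕ × Letter), k < l → φ[k]? = some p → φ[l]? = some p →
    p.2.primed = false)

def IsIndexStrict (φ : List (ℕ × Letter)) : Prop :=
  List.Chain' (fun p q : ℕ × Letter => p.1 < q.1) φ

/-! ## Sagan–Worley insertion (orthogonal and symplectic versions) -/

/-- Whether `u` bumps `v`: strict comparison when inserting an unprimed letter into a
row or a primed letter into a column, weak comparison otherwise. -/
def swBump (isRow : Bool) (u v : Letter) : Bool :=
  if (isRow && !u.primed) || (!isRow && u.primed) then decide (u < v) else decide (u ≤ v)

/-- Column stage of orthogonal Sagan–Worley insertion. -/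
def swColO : ℕ → STab → ℕ → Letter → STab × Bool
  | 0, T, _, _ => (T, true)
  | fuel + 1, T, c, u =>
    let occ := (List.range (c + 1)).filterMap (fun r => (entry? T r c).map (fun x => (r, x)))
    match occ.find? (fun p => swBump false u p.2) with
    | none =>
        let r := occ.length
        let u' := if r = c ∧ u.primed then Letter.unprime u else u
        (setRowG T r ((T.getD r []) ++ [u']), true)
    | some p =>
        if p.1 = c then
          if u.ceil = p.2.ceil then swColO fuel T (c + 1) (Letter.unprime p.2)
          else
            let q := switchPrimes u p.2
            swColO fuel (setEntryG T p.1 c q.1) (c + 1) q.2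
        else swColO fuel (setEntryG T p.1 c u) (c + 1) p.2

/-- Row stage of orthogonal Sagan–Worley insertion. -/
def swRowO : ℕ → STab → ℕ → Letter → STab × Bool
  | 0, T, _, _ => (T, true)
  | fuel + 1, T, r, u =>
    let row := T.getD r []
    match row.findIdx? (fun v => swBump true u v) with
    | none =>
        if row.isEmpty ∧ u.primed then (setRowG T r [Letter.unprime u], true)
        else (setRowG T r (row ++ [u]), false)
    | some k =>
        let v := row.getD k default
        if k = 0 then
          if u.ceil = v.ceil then swColO fuel T (r + 1) (Letter.unprime v)
          else
            let q := switchPrimes u v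
            swColO fuel (setRowG T r (row.set 0 q.1)) (r + 1) q.2
        else swRowO fuel (setRowG T r (row.set k u)) (r + 1) v

def swInsertO (T : STab) (u : Letter) : STab × Bool :=
  swRowO (T.flatten.length + T.length + 2) T 0 u

/-- Column stage of symplectic (original) Sagan–Worley insertion. -/
def swColSp : ℕ → STab → ℕ → Letter → STab × Bool
  | 0, T, _, _ => (T, true)
  | fuel + 1, T, c, u =>
    let occ := (List.range (c + 1)).filterMap (fun r => (entry? T r c).map (fun x => (r, x)))
    match occ.find? (fun p => swBump false u p.2) with
    | none => (setRowG T occ.length ((T.getD occ.length []) ++ [u]), true)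
    | some p =>
        if p.1 = c then
          if u.ceil = p.2.ceil then swColSp fuel T (c + 1) (Letter.unprime p.2)
          else swColSp fuel (setEntryG T p.1 c u) (c + 1) p.2
        else swColSp fuel (setEntryG T p.1 c u) (c + 1) p.2

/-- Row stage of symplectic (original) Sagan–Worley insertion. -/
def swRowSp : ℕ → STab → ℕ → Letter → STab × Bool
  | 0, T, _, _ => (T, true)
  | fuel + 1, T, r, u =>
    let row := T.getD r []
    match row.findIdx? (fun v => swBump true u v) with
    | none => (setRowG T r (row ++ [u]), false)
    | some k =>
        let v := row.getD k default
        if k = 0 then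
          if u.ceil = v.ceil then swColSp fuel T (r + 1) (Letter.unprime v)
          else swColSp fuel (setRowG T r (row.set 0 u)) (r + 1) v
        else swRowSp fuel (setRowG T r (row.set k u)) (r + 1) v

def swInsertSp (T : STab) (u : Letter) : STab × Bool :=
  swRowSp (T.flatten.length + T.length + 2) T 0 u

def PSWO (φ : List (ℕ × Letter)) : STab := φ.foldl (fun T p => (swInsertO T p.2).1) []

def PSWSp (φ : List (ℕ × Letter)) : STab := φ.foldl (fun T p => (swInsertSp T p.2).1) []

def QSWaux (ins : STab → Letter → STab × Bool) : STab → STab → List (ℕ × Letter) → STab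
  | _, Q, [] => Q
  | P, Q, p :: rest =>
      let res := ins P p.2
      QSWaux ins res.1 (addBox Q P res.1 ⟨(p.1 : ℤ), res.2⟩) rest

def QSWO (φ : List (ℕ × Letter)) : STab := QSWaux swInsertO [] [] φ

def QSWSp (φ : List (ℕ × Letter)) : STab := QSWaux swInsertSp [] [] φ

/-- Entry `A_{ij}` of the circled matrix of `φ` (forgetting the circles). -/
def cmEntry (φ : List (ℕ × Letter)) (i j : ℕ) : ℕ :=
  φ.countP (fun p => decide (p.1 = i ∧ p.2.ceil = (j : ℤ)))

/-! ## Shifted mixed insertion (orthogonal and symplectic versions) -/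

/-- Tableaux whose entries are signed letters `(ε, u)`, `ε ∈ {+, -}`
(`true` records the sign `-`). -/
abbrev MTab := List (List (Bool × Letter))

def extractO (U : MTab) : STab :=
  U.map (fun row =>
    match row with
    | [] => []
    | (e, x) :: rest => (if e then (⟨x.ceil, true⟩ : Letter) else x) :: rest.map Prod.snd)

def extractSp (U : MTab) : STab := U.map (List.map Prod.snd)

/-- One mixed insertion, of the pair `β` into row (`isCol = false`) or column
(`isCol = true`) number `idx`; returns the tableau and the added box. -/
def hmIns (sympl : Bool) : ℕ → MTab → Bool → ℕ → Bool × Letter → MTab × (ℕ × ℕ)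
  | 0, T, _, _, _ => (T, (0, 0))
  | fuel + 1, T, isCol, idx, β =>
    if isCol then
      let c := idx
      let occ := (List.range (c + 1)).filterMap
        (fun r => (entryG? T r c).map (fun x => (r, x)))
      match occ.find? (fun p => decide (β.2 < p.2.2)) with
      | none =>
          let r := occ.length
          (setRowG T r ((T.getD r []) ++ [β]), (r, c))
      | some p =>
          if p.1 = c then
            hmIns sympl fuel
              (setEntryG T p.1 c (if sympl then (p.2.1, β.2) else β)) true (c + 1)
              (if sympl then (β.1, ⟨p.2.2.ceil, true⟩) else (p.2.1, ⟨p.2.2.ceil, true⟩))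
          else
            hmIns sympl fuel (setEntryG T p.1 c (p.2.1, β.2)) p.2.2.primed
              (if p.2.2.primed then c + 1 else p.1 + 1) (β.1, p.2.2)
    else
      let r := idx
      let row := T.getD r []
      match row.findIdx? (fun p => decide (β.2 < p.2)) with
      | none => (setRowG T r (row ++ [β]), (r, r + row.length))
      | some k =>
          let q := row.getD k default
          if k = 0 then
            hmIns sympl fuel
              (setRowG T r (row.set 0 (if sympl then (q.1, β.2) else β))) true (r + 1)
              (if sympl then (β.1, ⟨q.2.ceil, true⟩) else (q.1, ⟨q.2.ceil, true⟩))
          else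
            hmIns sympl fuel (setRowG T r (row.set k (q.1, β.2))) q.2.primed
              (if q.2.primed then r + k + 1 else r + 1) (β.1, q.2)

def hmInsert (sympl : Bool) (T : MTab) (x : Letter) : MTab × (ℕ × ℕ) :=
  hmIns sympl (2 * T.flatten.length + 4) T false 0 (x.primed, ⟨x.ceil, false⟩)

def hmAuxCS (sympl : Bool) : MTab → STab → List (ℕ × Letter) → MTab × STab
  | U, Q, [] => (U, Q)
  | U, Q, p :: rest =>
      let res := hmInsert sympl U p.2
      let pos := res.2
      let sgn := ((entryG? res.1 pos.1 pos.2).map Prod.fst).getD false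
      let pr : Bool := if sympl then sgn else (decide (pos.1 ≠ pos.2) && sgn)
      hmAuxCS sympl res.1
        (setRowG Q pos.1 ((Q.getD pos.1 []) ++ [(⟨(p.1 : ℤ), pr⟩ : Letter)])) rest

def PHMO (φ : List (ℕ × Letter)) : STab := extractO (hmAuxCS false [] [] φ).1
def QHMO (φ : List (ℕ × Letter)) : STab := (hmAuxCS false [] [] φ).2
def PHMSp (φ : List (ℕ × Letter)) : STab := extractSp (hmAuxCS true [] [] φ).1
def QHMSp (φ : List (ℕ × Letter)) : STab := (hmAuxCS true [] [] φ).2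

/-- A primed word, identified with the primed compatible sequence with
index row `1, 2, …, n`. -/
def wordCS (a : PWord) : List (ℕ × Letter) :=
  ((List.range a.length).zip a).map (fun p => (p.1 + 1, p.2))

/-! ## The transpose of a primed compatible sequence -/

def insSortedCS (p : ℕ × Letter) : List (ℕ × Letter) → List (ℕ × Letter)
  | [] => [p]
  | q :: rest =>
      if p.1 < q.1 ∨ (p.1 = q.1 ∧ p.2 ≤ q.2) then p :: q :: rest
      else q :: insSortedCS p rest

def sortCS (l : List (ℕ × Letter)) : List (ℕ × Letter) := l.foldr insSortedCS []

/-- `φ^⊤`: move each prime from the value to the index above it, interchange the two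
rows, and reorder the columns lexicographically. -/
def transposeCS (φ : List (ℕ × Letter)) : List (ℕ × Letter) :=
  sortCS (φ.map (fun p => (p.2.ceil.toNat, (⟨(p.1 : ℤ), p.2.primed⟩ : Letter))))

/-! ## Demazure conjugation -/

/-- The right Demazure product `σ ∘ s_i`. -/
def demazureRight (σ : Equiv.Perm ℤ) (i : ℤ) : Equiv.Perm ℤ :=
  if σ i < σ (i + 1) then σ * sPerm i else σ

/-- The left Demazure product `s_i ∘ σ`. -/
def demazureLeft (i : ℤ) (σ : Equiv.Perm ℤ) : Equiv.Perm ℤ :=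
  if σ.symm i < σ.symm (i + 1) then sPerm i * σ else σ

theorem sPerm_apply (i p : ℤ) :
    sPerm i p = if p = i then i + 1 else if p = i + 1 then i else p := by
  simp [sPerm, Equiv.swap_apply_def]

theorem sPerm_mul_self (i : ℤ) : sPerm i * sPerm i = 1 :=
  Equiv.swap_mul_self _ _

theorem sPerm_symm (i : ℤ) : (sPerm i).symm = sPerm i :=
  Equiv.symm_swap _ _

/-- `s_x` preserves the relative order of `p` and `q` unless `{p, q} = {x, x + 1}`. -/
theorem sPerm_lt_sPerm_iff {x p q : ℤ} (h1 : ¬(p = x ∧ q = x + 1))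
    (h2 : ¬(p = x + 1 ∧ q = x)) : sPerm x p < sPerm x q ↔ p < q := by
  rw [sPerm_apply, sPerm_apply]
  split_ifs <;> omega

theorem sPerm_mul_eq_mul_sPerm {σ : Equiv.Perm ℤ} {x i : ℤ}
    (h : (σ i = x ∧ σ (i + 1) = x + 1) ∨ (σ i = x + 1 ∧ σ (i + 1) = x)) :
    sPerm x * σ = σ * sPerm i := by
  have : σ * sPerm i = Equiv.swap (σ i) (σ (i + 1)) * σ := by
    rw [sPerm, Equiv.mul_swap_eq_swap_mul]
  rw [this]
  rcases h with ⟨h1, h2⟩ | ⟨h1, h2⟩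
  · rw [h1, h2, sPerm]
  · rw [h1, h2, sPerm, Equiv.swap_comm]

theorem demazureLeft_demazureRight (x i : ℤ) (σ : Equiv.Perm ℤ) :
    demazureLeft x (demazureRight σ i) = demazureRight (demazureLeft x σ) i := by
  by_cases h : (σ i = x ∧ σ (i + 1) = x + 1) ∨ (σ i = x + 1 ∧ σ (i + 1) = x)
  · have hc := sPerm_mul_eq_mul_sPerm h
    rcases h with ⟨h1, h2⟩ | ⟨h1, h2⟩
    · have e1 : σ.symm x = i := by rw [← h1, Equiv.symm_apply_apply]
      have e2 : σ.symm (x + 1) = i + 1 := by rw [← h2, Equiv.symm_apply_apply]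
      have hR : demazureRight σ i = σ * sPerm i := by simp [demazureRight, h1, h2]
      have hL : demazureLeft x σ = σ * sPerm i := by simp [demazureLeft, e1, e2, hc]
      rw [hR, hL, demazureLeft, demazureRight, if_neg, if_neg]
      · simp [sPerm_apply, h1, h2]
      · simp [Equiv.Perm.mul_def, sPerm_symm, e1, e2, sPerm_apply]
    · have e1 : σ.symm (x + 1) = i := by rw [← h1, Equiv.symm_apply_apply]
      have e2 : σ.symm x = i + 1 := by rw [← h2, Equiv.symm_apply_apply]
      have hR : demazureRight σ i = σ := by simp [demazureRight, h1, h2]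
      have hL : demazureLeft x σ = σ := by simp [demazureLeft, e1, e2]
      rw [hR, hL, hR]
  · have key1 : sPerm x (σ i) < sPerm x (σ (i + 1)) ↔ σ i < σ (i + 1) :=
      sPerm_lt_sPerm_iff (fun hh => h (Or.inl hh)) (fun hh => h (Or.inr hh))
    have key2 : sPerm i (σ.symm x) < sPerm i (σ.symm (x + 1)) ↔
        σ.symm x < σ.symm (x + 1) := by
      apply sPerm_lt_sPerm_iff
      · rintro ⟨h1, h2⟩
        rw [Equiv.symm_apply_eq] at h1 h2
        exact h (Or.inl ⟨h1.symm, h2.symm⟩)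
      · rintro ⟨h1, h2⟩
        rw [Equiv.symm_apply_eq] at h1 h2
        exact h (Or.inr ⟨h2.symm, h1.symm⟩)
    have hsymm : ∀ p, (σ * sPerm i).symm p = sPerm i (σ.symm p) := fun p => by
      simp [Equiv.Perm.mul_def, sPerm_symm]
    by_cases hr : σ i < σ (i + 1) <;> by_cases hl : σ.symm x < σ.symm (x + 1) <;>
      simp [demazureLeft, demazureRight, hr, hl, hsymm, key1, key2, mul_assoc]

theorem heckeProd_append_singleton (w : List ℤ) (i : ℤ) :
    heckeProd (w ++ [i]) = demazureRight (heckeProd w) i := by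
  rw [heckeProd, List.foldl_append]
  rfl

theorem heckeProd_cons (x : ℤ) (w : List ℤ) :
    heckeProd (x :: w) = demazureLeft x (heckeProd w) := by
  induction w using List.reverseRecOn with
  | nil => simp [heckeProd, demazureLeft, show Equiv.symm (1 : Equiv.Perm ℤ) = 1 from rfl]
  | append_singleton w i ih =>
    rw [← List.cons_append, heckeProd_append_singleton, heckeProd_append_singleton, ih,
      demazureLeft_demazureRight]

/-- Demazure conjugation `s_x ∘ z ∘ s_x`. -/
def demazureConj (z : Equiv.Perm ℤ) (x : ℤ) : Equiv.Perm ℤ :=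
  demazureLeft x (demazureRight z x)

theorem invHecke_append_singleton (a : List ℤ) (x : ℤ) :
    invHecke (a ++ [x]) = demazureConj (invHecke a) x := by
  rcases a with _ | ⟨y, a⟩
  · simp [invHecke, heckeProd, demazureConj, demazureLeft, demazureRight, sPerm_symm,
      sPerm_apply]
  · have : (y :: a ++ [x]).reverse ++ (y :: a ++ [x]).tail =
        x :: (((y :: a).reverse ++ (y :: a).tail) ++ [x]) := by simp
    rw [invHecke, this, heckeProd_cons, heckeProd_append_singleton, demazureConj, invHecke]

theorem invHecke_append_congr {a b : List ℤ} (h : invHecke a = invHecke b) (c : List ℤ) :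
    invHecke (a ++ c) = invHecke (b ++ c) := by
  induction c using List.reverseRecOn with
  | nil => simpa using h
  | append_singleton c x ih =>
    rw [← List.append_assoc, ← List.append_assoc, invHecke_append_singleton,
      invHecke_append_singleton, ih]

theorem symm_eq_self_of_mul_self {z : Equiv.Perm ℤ} (hz : z * z = 1) : z.symm = z :=
  inv_eq_of_mul_eq_one_left hz

theorem apply_apply_of_mul_self {z : Equiv.Perm ℤ} (hz : z * z = 1) (p : ℤ) :
    z (z p) = p :=
  DFunLike.congr_fun hz p

theorem conj_mul_self {z s : Equiv.Perm ℤ} (hz : z * z = 1) (hs : s * s = 1) :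
    s * z * s * (s * z * s) = 1 := by
  calc s * z * s * (s * z * s) = s * z * (s * s) * z * s := by simp only [mul_assoc]
    _ = s * (z * z) * s := by rw [hs, mul_one]; simp only [mul_assoc]
    _ = 1 := by rw [hz, mul_one, hs]

theorem demazureConj_of_not_lt {z : Equiv.Perm ℤ} (hz : z * z = 1) {x : ℤ}
    (h : ¬z x < z (x + 1)) : demazureConj z x = z := by
  simp [demazureConj, demazureRight, demazureLeft, h, symm_eq_self_of_mul_self hz]

theorem demazureConj_of_fixed {z : Equiv.Perm ℤ} (hz : z * z = 1) {x : ℤ}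
    (h1 : z x = x) (h2 : z (x + 1) = x + 1) : demazureConj z x = z * sPerm x := by
  simp [demazureConj, demazureRight, demazureLeft, h1, h2, Equiv.Perm.mul_def,
    symm_eq_self_of_mul_self hz, sPerm_symm, sPerm_apply]

theorem demazureConj_of_lt {z : Equiv.Perm ℤ} (hz : z * z = 1) {x : ℤ}
    (h : z x < z (x + 1)) (hfix : ¬(z x = x ∧ z (x + 1) = x + 1)) :
    demazureConj z x = sPerm x * z * sPerm x := by
  have key : sPerm x (z x) < sPerm x (z (x + 1)) :=
    (sPerm_lt_sPerm_iff hfix (by omega)).2 h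
  have hsymm : ∀ p, (z * sPerm x).symm p = sPerm x (z p) := fun p => by
    simp [Equiv.Perm.mul_def, sPerm_symm, symm_eq_self_of_mul_self hz]
  simp [demazureConj, demazureRight, demazureLeft, h, hsymm, key, mul_assoc]

theorem demazureConj_mul_self {z : Equiv.Perm ℤ} (hz : z * z = 1) (x : ℤ) :
    demazureConj z x * demazureConj z x = 1 := by
  by_cases h : z x < z (x + 1)
  · by_cases hfix : z x = x ∧ z (x + 1) = x + 1
    · rw [demazureConj_of_fixed hz hfix.1 hfix.2]
      nth_rewrite 1 [← sPerm_mul_eq_mul_sPerm (Or.inl hfix)]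
      rw [mul_assoc, ← mul_assoc z, hz, one_mul, sPerm_mul_self]
    · rw [demazureConj_of_lt hz h hfix, conj_mul_self hz (sPerm_mul_self x)]
  · rw [demazureConj_of_not_lt hz h, hz]

theorem invHecke_mul_self (a : List ℤ) : invHecke a * invHecke a = 1 := by
  induction a using List.reverseRecOn with
  | nil => simp [invHecke, heckeProd]
  | append_singleton a x ih =>
    rw [invHecke_append_singleton]
    exact demazureConj_mul_self ih x

/-! ## Two-cycles under conjugation -/

/-- The action of `σ` on two-element sets, recorded as ordered pairs. -/
def pairMap (σ : Equiv.Perm ℤ) (p : ℤ × ℤ) : ℤ × ℤ :=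
  (min (σ p.1) (σ p.2), max (σ p.1) (σ p.2))

theorem pairMap_min_max (σ : Equiv.Perm ℤ) (u v : ℤ) :
    pairMap σ (min u v, max u v) = (min (σ u) (σ v), max (σ u) (σ v)) := by
  rcases le_total u v with h | h
  · simp [pairMap, h]
  · simp [pairMap, h, min_comm, max_comm]

theorem mem_cycSet_min_max {z : Equiv.Perm ℤ} (hz : z * z = 1) {u v : ℤ} (hne : u ≠ v)
    (h : z u = v) : (min u v, max u v) ∈ cycSet z := by
  rcases lt_or_gt_of_ne hne with hlt | hlt
  · simpa [cycSet, min_eq_left hlt.le, max_eq_right hlt.le] using ⟨hlt, h⟩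
  · simpa [cycSet, min_eq_right hlt.le, max_eq_left hlt.le] using
      ⟨hlt, by rw [← h, apply_apply_of_mul_self hz]⟩

theorem pairMap_mem_cycSet_conj {z s : Equiv.Perm ℤ} (hz : z * z = 1) (hs : s * s = 1)
    {p : ℤ × ℤ} (hp : p ∈ cycSet z) : pairMap s p ∈ cycSet (s * z * s) := by
  have hzs := conj_mul_self hz hs
  refine mem_cycSet_min_max hzs (fun h => hp.1.ne (s.injective h)) ?_
  simp [apply_apply_of_mul_self hs, hp.2]

theorem pairMap_pairMap_of_lt {s : Equiv.Perm ℤ} (hs : s * s = 1) {p : ℤ × ℤ}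
    (hp : p.1 < p.2) : pairMap s (pairMap s p) = p := by
  have := pairMap_min_max s (s p.1) (s p.2)
  rw [← pairMap] at this
  rw [this, apply_apply_of_mul_self hs, apply_apply_of_mul_self hs,
    min_eq_left hp.le, max_eq_right hp.le]

theorem bijOn_pairMap_cycSet_conj {z s : Equiv.Perm ℤ} (hz : z * z = 1) (hs : s * s = 1) :
    Set.BijOn (pairMap s) (cycSet z) (cycSet (s * z * s)) := by
  have hzs := conj_mul_self hz hs
  refine Set.InvOn.bijOn (f' := pairMap s)
    ⟨fun p hp => pairMap_pairMap_of_lt hs hp.1, fun p hp => pairMap_pairMap_of_lt hs hp.1⟩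
    (fun p hp => pairMap_mem_cycSet_conj hz hs hp) (fun p hp => ?_)
  have hback : s * (s * z * s) * s = z := by
    calc s * (s * z * s) * s = (s * s) * z * (s * s) := by simp only [mul_assoc]
      _ = z := by rw [hs, one_mul, mul_one]
  have := pairMap_mem_cycSet_conj hzs hs hp
  rwa [hback] at this

theorem cycSet_mul_sPerm {z : Equiv.Perm ℤ} {x : ℤ} (h1 : z x = x)
    (h2 : z (x + 1) = x + 1) : cycSet (z * sPerm x) = insert (x, x + 1) (cycSet z) := by
  ext ⟨u, v⟩
  simp only [cycSet, Set.mem_ofPred_eq, Set.mem_insert_iff, Prod.mk.injEq,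
    Equiv.Perm.mul_apply, sPerm_apply]
  by_cases hu : u = x
  · subst hu
    simp only [if_true, true_and, h1, h2]
    omega
  · by_cases hu' : u = x + 1
    · subst hu'
      simp only [hu, if_false, if_true, false_and, false_or, h1, h2]
      omega
    · simp [hu, hu']

/-! ## Commutations in words -/

theorem suffixPerm_append_singleton {a : List ℤ} {k : ℕ} (hk : k < a.length) (x : ℤ) :
    suffixPerm (a ++ [x]) k = sPerm x * suffixPerm a k := by
  simp [suffixPerm, List.drop_append_of_le_length (show k + 1 ≤ a.length from hk)]

theorem gammaPair_append_singleton {a : List ℤ} {k : ℕ} (hk : k < a.length) (x : ℤ) :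
    gammaPair (a ++ [x]) k = pairMap (sPerm x) (gammaPair a k) := by
  simp [gammaPair, List.getElem?_append_left hk, List.getElem?_eq_getElem hk,
    suffixPerm_append_singleton hk, pairMap_min_max]

theorem gammaPair_append_singleton_length (a : List ℤ) (x : ℤ) :
    gammaPair (a ++ [x]) a.length = (x, x + 1) := by
  simp [gammaPair, suffixPerm]

theorem isCommutation_append_singleton {a : List ℤ} {k : ℕ} (hk : k < a.length) (x : ℤ) :
    IsCommutation (a ++ [x]) k ↔ IsCommutation a k := by
  simp only [IsCommutation, List.getElem?_append_left hk,
    List.take_append_of_le_length hk.le]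

theorem isCommutation_append_singleton_length (a : List ℤ) (x : ℤ) :
    IsCommutation (a ++ [x]) a.length ↔ invHecke a x = x ∧ invHecke a (x + 1) = x + 1 := by
  simp [IsCommutation]

theorem bijOn_gammaPair_of_ascents (a : List ℤ)
    (h : ∀ b x c, a = b ++ x :: c → invHecke b x < invHecke b (x + 1)) :
    Set.BijOn (gammaPair a) {k : ℕ | k < a.length ∧ IsCommutation a k}
      (cycSet (invHecke a)) := by
  induction a using List.reverseRecOn with
  | nil =>
    have h1 : {k : ℕ | k < ([] : List ℤ).length ∧ IsCommutation [] k} = ∅ := by ext; simp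
    have h2 : cycSet (invHecke []) = ∅ := by
      ext ⟨u, v⟩
      simp only [cycSet, invHecke, heckeProd, List.reverse_nil, List.tail_nil, List.append_nil,
        List.foldl_nil, Equiv.Perm.one_apply, Set.mem_ofPred_eq, Set.mem_empty_iff_false, iff_false]
      omega
    rw [h1, h2]
    exact Set.bijOn_empty _
  | append_singleton a x ih =>
    have hlt : invHecke a x < invHecke a (x + 1) := h a x [] rfl
    have hz := invHecke_mul_self a
    have ih := ih fun b y c hb => h b y (c ++ [x]) (by simp [hb])
    have hcomp : Set.BijOn (gammaPair (a ++ [x])) {k : ℕ | k < a.length ∧ IsCommutation a k}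
        (cycSet (sPerm x * invHecke a * sPerm x)) :=
      ((bijOn_pairMap_cycSet_conj hz (sPerm_mul_self x)).comp ih).congr
        fun k hk => (gammaPair_append_singleton hk.1 x).symm
    have hset : ∀ k, k ≠ a.length →
        ((k < (a ++ [x]).length ∧ IsCommutation (a ++ [x]) k) ↔
          (k < a.length ∧ IsCommutation a k)) := fun k hne => by
      rw [List.length_append, List.length_singleton]
      constructor
      · rintro ⟨hk, hc⟩
        have hk' : k < a.length := by omega
        exact ⟨hk', (isCommutation_append_singleton hk' x).1 hc⟩
      · rintro ⟨hk, hc⟩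
        exact ⟨by omega, (isCommutation_append_singleton hk x).2 hc⟩
    rw [invHecke_append_singleton]
    by_cases hfix : invHecke a x = x ∧ invHecke a (x + 1) = x + 1
    · have hdom : {k : ℕ | k < (a ++ [x]).length ∧ IsCommutation (a ++ [x]) k} =
          insert a.length {k : ℕ | k < a.length ∧ IsCommutation a k} := by
        ext k
        by_cases hk : k = a.length
        · subst hk
          simp [(isCommutation_append_singleton_length a x).2 hfix]
        · simpa [hk] using hset k hk
      have hconj : sPerm x * invHecke a * sPerm x = invHecke a := by
        rw [sPerm_mul_eq_mul_sPerm (Or.inl hfix), mul_assoc, sPerm_mul_self, mul_one]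
      rw [hconj] at hcomp
      rw [hdom, demazureConj_of_fixed hz hfix.1 hfix.2, cycSet_mul_sPerm hfix.1 hfix.2,
        ← gammaPair_append_singleton_length a x]
      refine hcomp.insert ?_
      rw [gammaPair_append_singleton_length]
      intro hmem
      have := hmem.2
      simp only [hfix.1] at this
      omega
    · have hdom : {k : ℕ | k < (a ++ [x]).length ∧ IsCommutation (a ++ [x]) k} =
          {k : ℕ | k < a.length ∧ IsCommutation a k} := by
        ext k
        by_cases hk : k = a.length
        · subst hk
          simp [isCommutation_append_singleton_length, hfix]
        · exact hset k hk
      rw [hdom, demazureConj_of_lt hz hlt hfix]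
      exact hcomp

theorem invHecke_lt_of_mem_Rinv {z : Equiv.Perm ℤ} {b c : List ℤ} {x : ℤ}
    (ha : b ++ x :: c ∈ Rinv z) : invHecke b x < invHecke b (x + 1) := by
  by_contra hlt
  have hb : invHecke (b ++ [x]) = invHecke b := by
    rw [invHecke_append_singleton, demazureConj_of_not_lt (invHecke_mul_self b) hlt]
  have hbc : invHecke (b ++ c) = z := by
    rw [← invHecke_append_congr hb c, ← ha.1, List.append_assoc, List.singleton_append]
  have := ha.2 _ hbc
  simp at this

/-- Proposition 3.43: for an involution word `a ∈ R_inv(z)`, the map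
`k ↦ γ_k(a)` is a bijection from the commutations of `a` to the 2-cycles of `z`. -/
theorem stmt16 (z : Equiv.Perm ℤ) (hz : IZ z) (a : List ℤ) (ha : a ∈ Rinv z) :
    Set.BijOn (gammaPair a) {k : ℕ | k < a.length ∧ IsCommutation a k} (cycSet z) := by
  obtain rfl := ha.1
  exact bijOn_gammaPair_of_ascents a fun b x c hb => invHecke_lt_of_mem_Rinv (hb ▸ ha)
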